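/- Let p, q, r be real numbers with p > q > 0, r ≥ 0, and q·r/(p−q) < p/q, and suppose in addition that q ≥ 1 or p ≤ 1. Set f(x,y) = (r + p·x + y)/(q·x + y), and let m̃, M̃ be reals with q·r/(p−q) < m̃ ≤ M̃ < p/q such that f(x,y) ∈ [m̃, M̃] for all x, y ∈ [m̃, M̃]. Then every sequence (x_n)_{n≥-1} with x_{-1}, x_0 ∈ [m̃, M̃] satisfying x_{n+1} = f(x_n, x_{n-1}) for all n ≥ 0 converges to the equilibrium ȳ = (p+1+√((p+1)² + 4r(q+1)))/(2(q+1)). -/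

import Mathlib

open Filter Topology Set

/-- A bounded solution of `x (n + 2) = f (x (n + 1)) (x n)`, with `f` increasing in its first and
decreasing in its second argument, satisfies `limsup x ≤ f (limsup x) (liminf x)` and
`f (liminf x) (limsup x) ≤ liminf x`. -/
theorem limsup_le_and_le_liminf_of_mixed_monotone {f : ℝ → ℝ → ℝ} {c a b : ℝ} (hca : c < a)
    {x : ℕ → ℝ} (hx : ∀ n, x n ∈ Icc a b)
    (hrec : ∀ n, x (n + 2) = f (x (n + 1)) (x n))
    (hmono : ∀ u v u' v', c < u → u ≤ u' → c < v' → v' ≤ v → f u v ≤ f u' v')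
    (hcont : ∀ u v, c < u → c < v → ContinuousAt (Function.uncurry f) (u, v)) :
    limsup x atTop ≤ f (limsup x atTop) (liminf x atTop) ∧
      f (liminf x atTop) (limsup x atTop) ≤ liminf x atTop := by
  have hbelow : IsBoundedUnder (· ≥ ·) atTop x := isBoundedUnder_of ⟨a, fun n => (hx n).1⟩
  have habove : IsBoundedUnder (· ≤ ·) atTop x := isBoundedUnder_of ⟨b, fun n => (hx n).2⟩
  set m := liminf x atTop
  set M := limsup x atTop
  have ham : a ≤ m :=
    le_liminf_of_le habove.isCoboundedUnder_ge (Eventually.of_forall fun n => (hx n).1)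
  have hmM : m ≤ M := liminf_le_limsup habove hbelow
  have hbounds : ∀ ε > 0, ∀ᶠ n in atTop, m - ε < x n ∧ x n < M + ε := fun ε hε =>
    (eventually_lt_of_lt_liminf (by linarith) hbelow).and
      (eventually_lt_of_limsup_lt (by linarith) habove)
  have hsmall : ∀ᶠ ε in 𝓝[>] (0 : ℝ), 0 < ε ∧ ε < m - c :=
    Ioo_mem_nhdsGT (by linarith)
  have hsub : Tendsto (fun ε : ℝ => m - ε) (𝓝[>] 0) (𝓝 m) :=
    ((continuous_const.sub continuous_id).tendsto' 0 m (sub_zero m)).mono_left nhdsWithin_le_nhds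
  have hadd : Tendsto (fun ε : ℝ => M + ε) (𝓝[>] 0) (𝓝 M) :=
    ((continuous_const.add continuous_id).tendsto' 0 M (add_zero M)).mono_left nhdsWithin_le_nhds
  constructor
  · refine ge_of_tendsto ((hcont M m (by linarith) (by linarith)).tendsto.comp
      (hadd.prodMk_nhds hsub)) ?_
    filter_upwards [hsmall] with ε hε
    refine (limsup_nat_add x 2).symm.trans_le (limsup_le_of_le
      (isBoundedUnder_of ⟨a, fun n => (hx _).1⟩).isCoboundedUnder_le ?_)
    filter_upwards [hbounds ε hε.1, (tendsto_add_atTop_nat 1).eventually (hbounds ε hε.1)]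
      with n h0 h1
    rw [hrec]
    exact hmono _ _ _ _ (hca.trans_le (hx _).1) h1.2.le (by linarith) h0.1.le
  · refine le_of_tendsto ((hcont m M (by linarith) (by linarith)).tendsto.comp
      (hsub.prodMk_nhds hadd)) ?_
    filter_upwards [hsmall] with ε hε
    refine (le_liminf_of_le
      (isBoundedUnder_of ⟨b, fun n => (hx _).2⟩).isCoboundedUnder_ge ?_).trans_eq
        (liminf_nat_add x 2)
    filter_upwards [hbounds ε hε.1, (tendsto_add_atTop_nat 1).eventually (hbounds ε hε.1)]
      with n h0 h1
    rw [hrec]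
    exact hmono _ _ _ _ (by linarith) h1.1.le (hca.trans_le (hx _).1) h0.2.le

/-- `(r + p * u + v) / (q * u + v)` is increasing in `u` and decreasing in `v` where both exceed
`q * r / (p - q)`. -/
theorem rational_map_mixed_monotone {p q r u v u' v' : ℝ} (hq : 0 < q) (hpq : q < p) (hr : 0 ≤ r)
    (hu : q * r / (p - q) < u) (huu : u ≤ u') (hv : q * r / (p - q) < v') (hvv : v' ≤ v) :
    (r + p * u + v) / (q * u + v) ≤ (r + p * u' + v') / (q * u' + v') := by
  have hd : 0 < p - q := sub_pos.2 hpq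
  have hc : 0 ≤ q * r / (p - q) := by positivity
  have hu0 : 0 < u := hc.trans_lt hu
  have hv0 : 0 < v' := hc.trans_lt hv
  have hu0' : 0 < u' := hu0.trans_le huu
  have hv0' : 0 < v := hv0.trans_le hvv
  have hqr : q * r < v' * (p - q) := (div_lt_iff₀ hd).1 hv
  calc (r + p * u + v) / (q * u + v) ≤ (r + p * u + v') / (q * u + v') := by
        rw [div_le_div_iff₀ (by positivity) (by positivity)]
        nlinarith [mul_nonneg (sub_nonneg.2 hvv) (add_nonneg hr (mul_pos hd hu0).le)]
    _ ≤ (r + p * u' + v') / (q * u' + v') := by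
        rw [div_le_div_iff₀ (by positivity) (by positivity)]
        nlinarith [mul_nonneg (sub_nonneg.2 huu) (sub_pos.2 hqr).le]

theorem eq_of_mixed_inequalities {p q r m M : ℝ} (hq : 0 < q) (hr : 0 ≤ r)
    (hextra : 1 ≤ q ∨ p ≤ 1) (hm : 0 < m) (hmM : m ≤ M)
    (hM_le : M * (q * M + m) ≤ r + p * M + m) (hle_m : r + p * m + M ≤ m * (q * m + M)) :
    m = M := by
  by_contra hne
  have hlt : m < M := lt_of_le_of_ne hmM hne
  have hsum : q * (M + m) ≤ p - 1 := by
    refine le_of_mul_le_mul_right ?_ (sub_pos.2 hlt)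
    linarith
  rcases hextra with h | h
  · nlinarith [mul_nonneg (sub_nonneg.2 h) (hm.trans hlt).le]
  · nlinarith [mul_pos hq (add_pos (hm.trans hlt) hm)]

theorem eq_equilibrium {p q r L : ℝ} (hp : 0 < p) (hq : 0 < q) (hr : 0 ≤ r) (hL : 0 < L)
    (h : L * (q * L + L) = r + p * L + L) :
    L = (p + 1 + Real.sqrt ((p + 1) ^ 2 + 4 * r * (q + 1))) / (2 * (q + 1)) := by
  have hge : p + 1 ≤ (q + 1) * L := by
    refine le_of_mul_le_mul_right ?_ hL
    linarith
  have hsqrt : Real.sqrt ((p + 1) ^ 2 + 4 * r * (q + 1)) = 2 * (q + 1) * L - (p + 1) := by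
    rw [show (p + 1) ^ 2 + 4 * r * (q + 1) = (2 * (q + 1) * L - (p + 1)) ^ 2 by
      linear_combination -4 * (q + 1) * h]
    exact Real.sqrt_sq (by linarith)
  rw [hsqrt]
  field_simp
  ring

/-- Lemma: under the hypotheses of the proposition, if moreover `q ≥ 1` or `p ≤ 1`, every solution starting in the invariant interval converges to the equilibrium.
Here `x 0` plays the role of `x_{-1}` and `x 1` of `x_0`. -/
theorem stmt_8 (p q r : ℝ) (hq : 0 < q) (hpq : q < p) (hr : 0 ≤ r)
    (hcond : q * r / (p - q) < p / q)
    (hextra : 1 ≤ q ∨ p ≤ 1)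
    (mt Mt : ℝ) (hmt : q * r / (p - q) < mt) (hmM : mt ≤ Mt) (hMt : Mt < p / q)
    (hinv : ∀ x ∈ Icc mt Mt, ∀ y ∈ Icc mt Mt,
      (r + p * x + y) / (q * x + y) ∈ Icc mt Mt)
    (x : ℕ → ℝ) (hx0 : x 0 ∈ Icc mt Mt) (hx1 : x 1 ∈ Icc mt Mt)
    (hrec : ∀ n : ℕ, x (n + 2) = (r + p * x (n + 1) + x n) / (q * x (n + 1) + x n)) :
    Tendsto x atTop
      (nhds ((p + 1 + Real.sqrt ((p + 1) ^ 2 + 4 * r * (q + 1))) / (2 * (q + 1)))) := by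
  have hd : 0 < p - q := sub_pos.2 hpq
  have hc : 0 ≤ q * r / (p - q) := by positivity
  have hx : ∀ n, x n ∈ Icc mt Mt := by
    have hpair : ∀ n, x n ∈ Icc mt Mt ∧ x (n + 1) ∈ Icc mt Mt := by
      intro n
      induction n with
      | zero => exact ⟨hx0, hx1⟩
      | succ n ih =>
        refine ⟨ih.2, ?_⟩
        rw [hrec]
        exact hinv _ ih.2 _ ih.1
    exact fun n => (hpair n).1
  have hbelow : IsBoundedUnder (· ≥ ·) atTop x := isBoundedUnder_of ⟨mt, fun n => (hx n).1⟩
  have habove : IsBoundedUnder (· ≤ ·) atTop x := isBoundedUnder_of ⟨Mt, fun n => (hx n).2⟩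
  have hm : 0 < liminf x atTop := (hc.trans_lt hmt).trans_le <|
    le_liminf_of_le habove.isCoboundedUnder_ge (Eventually.of_forall fun n => (hx n).1)
  have hmM' : liminf x atTop ≤ limsup x atTop := liminf_le_limsup habove hbelow
  have hM : 0 < limsup x atTop := hm.trans_le hmM'
  obtain ⟨h1, h2⟩ := limsup_le_and_le_liminf_of_mixed_monotone
    (f := fun u v => (r + p * u + v) / (q * u + v)) hmt hx hrec
    (fun u v u' v' hu huu hv hvv => rational_map_mixed_monotone hq hpq hr hu huu hv hvv)
    (fun u v hu hv => by
      have hu0 := hc.trans_lt hu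
      have hv0 := hc.trans_lt hv
      have hne : q * u + v ≠ 0 := by positivity
      refine ContinuousAt.div (f := fun z : ℝ × ℝ => r + p * z.1 + z.2)
        (g := fun z : ℝ × ℝ => q * z.1 + z.2) ?_ ?_ hne <;> fun_prop)
  rw [le_div_iff₀ (by positivity)] at h1
  rw [div_le_iff₀ (by positivity)] at h2
  have heq := eq_of_mixed_inequalities hq hr hextra hm hmM' h1 h2
  rw [← heq] at h1
  rw [← heq] at h2
  rw [← eq_equilibrium (hq.trans hpq) hq hr hm (le_antisymm h1 h2)]
  exact tendsto_of_liminf_eq_limsup rfl heq.symm habove hbelow
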